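/- Let N ≥ 2, let {(u_i,w_i)}_{i=1}^m ⊆ S^{N-1} × [0,∞) be an ε-accurate quadrature, let 𝒮 = {u_i}_{i=1}^m have dispersion δ = disp(𝒮), and assume ε, δ ≤ 1/(10√N). Then 𝒞^0 ⊆ 𝒟^γ for γ = 16√N ‖C‖_∞ (2ε + δ) + L_C δ. -/

import Mathlib

open MeasureTheory Metric Set TopologicalSpace Filter
open scoped RealInnerProductSpace NNReal ENNReal

noncomputable section

abbrev Euc (N : ℕ) := EuclideanSpace ℝ (Fin N)

/-- The outreach (support) function of a set. -/
def outreach {N : ℕ} (B : Set (Euc N)) (u : Euc N) : ℝ :=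
  sSup ((fun b => ⟪b, u⟫) '' B)

/-- The half-space `Π⁻(u,b)`. -/
def halfSpace {N : ℕ} (u : Euc N) (b : ℝ) : Set (Euc N) := {x | ⟪u, x⟫ ≤ b}

/-- The uniform probability measure on the unit sphere. -/
def sphereMeasure (N : ℕ) : Measure (Metric.sphere (0 : Euc N) 1) :=
  (((volume : Measure (Euc N)).toSphere) Set.univ)⁻¹ • ((volume : Measure (Euc N)).toSphere)

/-- The sup-norm of a function restricted to the unit sphere. -/
def supNormSphere {N : ℕ} (f : Euc N → ℝ) : ℝ :=
  ⨆ x : Metric.sphere (0 : Euc N) 1, |f x|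

/-- The dispersion of a set of directions. -/
def dispersion {N : ℕ} (S : Set (Euc N)) : ℝ :=
  ⨆ u : Metric.sphere (0 : Euc N) 1, ⨅ v : S, ‖(u : Euc N) - (v : Euc N)‖

/-- `ε`-accurate quadrature on the unit sphere. -/
def IsAccurateQuadrature {N : ℕ} {ι : Type*} [Fintype ι]
    (u : ι → Euc N) (w : ι → ℝ) (ε : ℝ) : Prop :=
  (∀ i, u i ∈ Metric.sphere (0 : Euc N) 1) ∧ (∀ i, 0 ≤ w i) ∧
  ∀ (L : ℝ≥0) (f : Euc N → ℝ), LipschitzOnWith L f (Metric.sphere (0 : Euc N) 1) →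
    |(∫ x : Metric.sphere (0 : Euc N) 1, f x ∂(sphereMeasure N)) - ∑ i, w i * f (u i)|
      ≤ ε * (L + supNormSphere f)

/-- Halved mean width. -/
def meanHalfWidth {N : ℕ} (B : Set (Euc N)) : ℝ :=
  ∫ u : Metric.sphere (0 : Euc N) 1, outreach B (u : Euc N) ∂(sphereMeasure N)

/-- Feasible solutions of the continuous problem. -/
def CInf {N : ℕ} (C : Euc N → ℝ) : Set (Set (Euc N)) :=
  {B | B.Nonempty ∧ Convex ℝ B ∧ IsCompact B ∧
    ∀ u ∈ Metric.sphere (0 : Euc N) 1, C u ≤ outreach B u}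

/-- Optimal value of the continuous problem. -/
def VCP {N : ℕ} (C : Euc N → ℝ) : ℝ := sInf (meanHalfWidth '' CInf C)

/-- `γ`-near optimal solutions of the continuous problem. -/
def CGamma {N : ℕ} (C : Euc N → ℝ) (γ : ℝ) : Set (Set (Euc N)) :=
  {B ∈ CInf C | meanHalfWidth B - VCP C ≤ γ}

/-- Feasible solutions of the discrete problem with node set `S`. -/
def DInf {N : ℕ} (C : Euc N → ℝ) (S : Set (Euc N)) : Set (Set (Euc N)) :=
  {B | B.Nonempty ∧ Convex ℝ B ∧ IsCompact B ∧ ∀ u ∈ S, C u ≤ outreach B u}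

/-- Discrete objective. -/
def quadSum {N : ℕ} {ι : Type*} [Fintype ι] (u : ι → Euc N) (w : ι → ℝ)
    (B : Set (Euc N)) : ℝ :=
  ∑ i, w i * outreach B (u i)

/-- Optimal value of the discrete problem. -/
def VDP {N : ℕ} {ι : Type*} [Fintype ι] (u : ι → Euc N) (w : ι → ℝ) (C : Euc N → ℝ) : ℝ :=
  sInf (quadSum u w '' DInf C (Set.range u))

/-- `γ`-near optimal solutions of the discrete problem. -/
def DGamma {N : ℕ} {ι : Type*} [Fintype ι] (u : ι → Euc N) (w : ι → ℝ) (C : Euc N → ℝ)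
    (γ : ℝ) : Set (Set (Euc N)) :=
  {B ∈ DInf C (Set.range u) | quadSum u w B - VDP u w C ≤ γ}


open ProbabilityTheory in
lemma stdG_density (N : ℕ) : ∃ Z : ℝ, 0 < Z ∧ ∀ f : Euc N → ℝ,
    ∫ x, f x ∂(stdGaussian (Euc N)) = Z⁻¹ * ∫ x : Euc N, f x * Real.exp (-(1/2) * ‖x‖ ^ 2) := by
  set Z : ℝ := ∫ x : Euc N, Real.exp (-(1/2) * ‖x‖ ^ 2) with hZ
  have hZv : Z = (Real.pi / (1/2)) ^ (Module.finrank ℝ (Euc N) / 2 : ℝ) :=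
    GaussianFourier.integral_rexp_neg_mul_sq_norm (V := Euc N) (b := 1/2) (by norm_num)
  have hZ0 : 0 < Z := by rw [hZv]; positivity
  have hint : Integrable (fun x : Euc N => Real.exp (-(1/2) * ‖x‖ ^ 2)) := by
    by_contra h
    rw [hZ, integral_undef h] at hZ0
    exact lt_irrefl _ hZ0
  set φ : Euc N → ℝ≥0 := fun x => Real.toNNReal (Z⁻¹ * Real.exp (-(1/2) * ‖x‖ ^ 2)) with hφ
  have hφm : Measurable φ := by fun_prop
  have hφc : ∀ x, ((φ x : ℝ≥0) : ℝ) = Z⁻¹ * Real.exp (-(1/2) * ‖x‖ ^ 2) := fun x =>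
    Real.coe_toNNReal _ (by positivity)
  set P : Measure (Euc N) := volume.withDensity (fun x => (φ x : ℝ≥0∞)) with hP
  have hfin : IsFiniteMeasure P := by
    apply isFiniteMeasure_withDensity_ofReal
    exact (hint.const_mul Z⁻¹).2
  have hPeq : P = stdGaussian (Euc N) := by
    apply Measure.ext_of_charFun
    ext t
    rw [charFun_stdGaussian, charFun_apply, hP, integral_withDensity_eq_integral_smul hφm]
    have h1 : ∀ x : Euc N, φ x • Complex.exp (⟪x, t⟫ * Complex.I) =
        (Z⁻¹ : ℂ) * Complex.exp (-((1/2 : ℂ)) * ‖x‖ ^ 2 + Complex.I * ⟪t, x⟫) := by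
      intro x
      rw [NNReal.smul_def, hφc, Complex.real_smul, Complex.exp_add, real_inner_comm]
      push_cast
      rw [mul_comm Complex.I]
      ring
    simp_rw [h1]
    rw [integral_const_mul, GaussianFourier.integral_cexp_neg_mul_sq_norm_add (by norm_num)]
    have h2 : ((Real.pi : ℂ) / (1/2)) ^ (Module.finrank ℝ (Euc N) / 2 : ℂ) = (Z : ℂ) := by
      rw [hZv, Complex.ofReal_cpow (by positivity)]
      push_cast
      rfl
    rw [h2, ← mul_assoc, inv_mul_cancel₀ (by exact_mod_cast hZ0.ne'), one_mul, Complex.I_sq]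
    congr 1
    ring
  refine ⟨Z, hZ0, fun f => ?_⟩
  rw [← hPeq, hP, integral_withDensity_eq_integral_smul hφm, ← integral_const_mul]
  congr 1
  ext x
  rw [NNReal.smul_def, hφc, smul_eq_mul]
  ring

lemma polar_hom {N : ℕ} (hN : 2 ≤ N) (f : Euc N → ℝ)
    (hf : ∀ (r : ℝ) (x : Euc N), 0 < r → f (r • x) = r * f x) :
    ∫ x : Euc N, f x * Real.exp (-(1/2) * ‖x‖ ^ 2) =
      (∫ s : sphere (0 : Euc N) 1, f s ∂(volume : Measure (Euc N)).toSphere) *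
      ∫ r : Ioi (0:ℝ), (r : ℝ) * Real.exp (-(1/2) * (r : ℝ) ^ 2)
        ∂(Measure.volumeIoiPow (Module.finrank ℝ (Euc N) - 1)) := by
  have : Nonempty (Fin N) := ⟨⟨0, by omega⟩⟩
  have : Nontrivial (Euc N) := inferInstance
  have key := (volume : Measure (Euc N)).measurePreserving_homeomorphUnitSphereProd.integral_comp
        (Homeomorph.measurableEmbedding _)
        (fun p : sphere (0 : Euc N) 1 × Ioi (0:ℝ) =>
          f p.1 * ((p.2 : ℝ) * Real.exp (-(1/2) * (p.2 : ℝ) ^ 2)))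
  rw [integral_prod_mul (fun s : sphere (0 : Euc N) 1 => f s)
    (fun r : Ioi (0:ℝ) => (r : ℝ) * Real.exp (-(1/2) * (r : ℝ) ^ 2))] at key
  rw [← key]
  have h0 := integral_subtype_comap (μ := (volume : Measure (Euc N)))
    (measurableSet_singleton (0 : Euc N)).compl
      (fun x : Euc N => f x * Real.exp (-(1/2) * ‖x‖ ^ 2))
  rw [restrict_compl_singleton] at h0
  rw [← h0]
  congr 1
  ext x
  have hx : (x : Euc N) ≠ 0 := x.2
  have hx' : 0 < ‖(x : Euc N)‖ := norm_pos_iff.2 hx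
  have h1 := hf ‖(x : Euc N)‖ (‖(x : Euc N)‖⁻¹ • (x : Euc N)) hx'
  rw [smul_smul, mul_inv_cancel₀ hx'.ne', one_smul] at h1
  simp only [homeomorphUnitSphereProd_apply_fst_coe, homeomorphUnitSphereProd_apply_snd_coe]
  nth_rw 1 [h1]
  ring

lemma toSphere_univ_pos {N : ℕ} (hN : 2 ≤ N) :
    0 < (volume : Measure (Euc N)).toSphere.real univ := by
  have : Nonempty (Fin N) := ⟨⟨0, by omega⟩⟩
  have : Nontrivial (Euc N) := inferInstance
  rw [Measure.real, ENNReal.toReal_pos_iff]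
  refine ⟨?_, measure_lt_top _ _⟩
  rw [pos_iff_ne_zero, Ne, Measure.measure_univ_eq_zero]
  exact Measure.toSphere_ne_zero _

lemma sphere_prob {N : ℕ} (hN : 2 ≤ N) : IsProbabilityMeasure (sphereMeasure N) := by
  have h := toSphere_univ_pos hN
  constructor
  rw [sphereMeasure, Measure.smul_apply, smul_eq_mul, ENNReal.inv_mul_cancel]
  · intro h0
    rw [Measure.real, h0] at h
    simp at h
  · exact measure_ne_top _ _

lemma gaussReal_pos_part : ∫ x, max x 0 ∂(ProbabilityTheory.gaussianReal 0 1)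
    = (Real.sqrt (2 * Real.pi))⁻¹ := by
  rw [ProbabilityTheory.integral_gaussianReal_eq_integral_smul one_ne_zero]
  have h1 : ∀ x : ℝ, ProbabilityTheory.gaussianPDFReal 0 1 x • max x 0 =
      (Ioi (0:ℝ)).indicator (fun x => (Real.sqrt (2 * Real.pi))⁻¹ *
        (x ^ (1:ℝ) * Real.exp (-(1/2) * x ^ (2:ℝ)))) x := by
    intro x
    by_cases hx : 0 < x
    · rw [indicator_of_mem (by exact hx), max_eq_left hx.le, ProbabilityTheory.gaussianPDFReal]
      simp
      ring_nf
    · rw [indicator_of_notMem (by exact hx), max_eq_right (not_lt.1 hx)]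
      simp
  simp_rw [h1]
  rw [integral_indicator measurableSet_Ioi, integral_const_mul,
    integral_rpow_mul_exp_neg_mul_rpow (by norm_num) (by norm_num) (by norm_num)]
  norm_num [Real.Gamma_one]

open ProbabilityTheory in
lemma stdG_pos_part {N : ℕ} (b : Euc N) (hb : ‖b‖ = 1) :
    ∫ x, max ⟪b, x⟫ 0 ∂(stdGaussian (Euc N)) = (Real.sqrt (2 * Real.pi))⁻¹ := by
  rw [← gaussReal_pos_part]
  have h := IsGaussian.map_eq_gaussianReal (μ := stdGaussian (Euc N)) (innerSL ℝ b)
  rw [integral_strongDual_stdGaussian, variance_dual_stdGaussian, innerSL_apply_norm, hb] at h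
  simp at h
  rw [← h, integral_map (by fun_prop) (by fun_prop)]

open ProbabilityTheory in
lemma stdG_norm {N : ℕ} (hN : 2 ≤ N) :
    ∫ x, ‖x‖ ∂(stdGaussian (Euc N)) ≤ Real.sqrt N := by
  have hm : MemLp id 2 (stdGaussian (Euc N)) := IsGaussian.memLp_two_id
  have hN0 : (0:ℝ) < Real.sqrt N := Real.sqrt_pos.2 (by positivity)
  have hsq : ∫ x, ‖x‖ ^ 2 ∂(stdGaussian (Euc N)) = N := by
    have e : ∀ x : Euc N, ‖x‖ ^ 2 = ∑ i : Fin N, (x i) ^ 2 := EuclideanSpace.real_norm_sq_eq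
    simp_rw [e]
    have hL : ∀ i : Fin N, MemLp (fun x : Euc N => x i) 2 (stdGaussian (Euc N)) := fun i =>
      (EuclideanSpace.proj (𝕜 := ℝ) i : Euc N →L[ℝ] ℝ).comp_memLp' hm
    rw [integral_finsetSum _ (fun i _ => (hL i).integrable_sq)]
    have h2 : ∀ i : Fin N, ∫ x : Euc N, (x i) ^ 2 ∂(stdGaussian (Euc N)) = 1 := by
      intro i
      have hv := variance_dual_stdGaussian (E := Euc N)
        (innerSL ℝ (EuclideanSpace.single i (1:ℝ)))
      rw [variance_of_integral_eq_zero (by fun_prop) (integral_strongDual_stdGaussian _),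
        innerSL_apply_norm] at hv
      have h5 : ∀ x : Euc N, innerSL ℝ (EuclideanSpace.single i (1:ℝ)) x = x i := by
        intro x
        rw [innerSL_apply_apply, EuclideanSpace.inner_single_left]
        simp
      simp_rw [h5] at hv
      rw [hv]
      simp
    simp [h2]
  have hi1 : Integrable (fun x : Euc N => ‖x‖) (stdGaussian (Euc N)) :=
    (IsGaussian.integrable_id (μ := stdGaussian (Euc N))).norm
  have hi2 : Integrable (fun x : Euc N => ‖x‖ ^ 2) (stdGaussian (Euc N)) := hm.integrable_norm_pow (by norm_num)
  calc ∫ x, ‖x‖ ∂(stdGaussian (Euc N))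
      ≤ ∫ x, (2 * Real.sqrt N)⁻¹ * ‖x‖ ^ 2 + Real.sqrt N / 2 ∂(stdGaussian (Euc N)) := by
        apply integral_mono hi1 ((hi2.const_mul _).add (integrable_const _))
        intro x
        have : (2 * Real.sqrt N)⁻¹ * ‖x‖ ^ 2 + Real.sqrt N / 2 - ‖x‖ =
          (2 * Real.sqrt N)⁻¹ * (‖x‖ - Real.sqrt N) ^ 2 := by field_simp; ring
        have h3 : 0 ≤ (2 * Real.sqrt N)⁻¹ * (‖x‖ - Real.sqrt N) ^ 2 := by positivity
        change ‖x‖ ≤ (2 * Real.sqrt N)⁻¹ * ‖x‖ ^ 2 + Real.sqrt N / 2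
        linarith
    _ = Real.sqrt N := by
        rw [integral_add (hi2.const_mul _) (integrable_const _), integral_const_mul, hsq]
        simp
        have := Real.sq_sqrt (Nat.cast_nonneg (α := ℝ) N)
        field_simp
        linarith

/-- key estimate -/
lemma sphere_pos_part {N : ℕ} (hN : 2 ≤ N) (b : Euc N) :
    0.398 / Real.sqrt N * ‖b‖ ≤
      ∫ x : sphere (0 : Euc N) 1, max ⟪b, (x : Euc N)⟫ 0 ∂(sphereMeasure N) := by
  have hN0 : (0:ℝ) < Real.sqrt N := Real.sqrt_pos.2 (by positivity)
  rcases eq_or_ne b 0 with rfl | hb0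
  · simp
  have hb : 0 < ‖b‖ := norm_pos_iff.2 hb0
  set v : Euc N := ‖b‖⁻¹ • b with hv
  have hv1 : ‖v‖ = 1 := by rw [hv, norm_smul, norm_inv, norm_norm, inv_mul_cancel₀ hb.ne']
  have hbv : b = ‖b‖ • v := by rw [hv, smul_smul, mul_inv_cancel₀ hb.ne', one_smul]
  have hsc : ∀ x : sphere (0 : Euc N) 1, max ⟪b, (x : Euc N)⟫ 0 = ‖b‖ * max ⟪v, (x : Euc N)⟫ 0 := by
    intro x
    rw [mul_max_of_nonneg _ _ hb.le, mul_zero, ← real_inner_smul_left, ← hbv]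
  simp_rw [hsc]
  rw [integral_const_mul, mul_comm]
  refine mul_le_mul_of_nonneg_left ?_ hb.le
  obtain ⟨Z, hZ, hZf⟩ := stdG_density N
  have p1 := polar_hom hN (fun x => max ⟪v, x⟫ 0) (by
    intro r x hr
    rw [mul_max_of_nonneg _ _ hr.le, mul_zero, real_inner_smul_right])
  have p2 := polar_hom hN (fun x => ‖x‖) (by
    intro r x hr
    rw [norm_smul, Real.norm_of_nonneg hr.le])
  have e1 := hZf (fun x => max ⟪v, x⟫ 0)
  have e2 := hZf (fun x => ‖x‖)
  rw [p1, stdG_pos_part v hv1] at e1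
  have hn := stdG_norm hN
  rw [e2, p2] at hn
  have hone : ∫ s : sphere (0 : Euc N) 1, ‖(s : Euc N)‖ ∂(volume : Measure (Euc N)).toSphere =
      (volume : Measure (Euc N)).toSphere.real univ := by
    simp
  rw [hone] at hn
  set T := (volume : Measure (Euc N)).toSphere.real univ with hT
  have hTpos : 0 < T := toSphere_univ_pos hN
  have hs : ∫ x : sphere (0 : Euc N) 1, max ⟪v, (x : Euc N)⟫ 0 ∂(sphereMeasure N) =
      T⁻¹ * ∫ x : sphere (0 : Euc N) 1, max ⟪v, (x : Euc N)⟫ 0 ∂(volume : Measure (Euc N)).toSphere := by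
    rw [sphereMeasure, integral_smul_measure, ENNReal.toReal_inv, smul_eq_mul]
    rfl
  rw [hs]
  set I := ∫ x : sphere (0 : Euc N) 1, max ⟪v, (x : Euc N)⟫ 0 ∂(volume : Measure (Euc N)).toSphere
  set K := ∫ r : Ioi (0:ℝ), (r : ℝ) * Real.exp (-(1/2) * (r : ℝ) ^ 2)
        ∂(Measure.volumeIoiPow (Module.finrank ℝ (Euc N) - 1))
  have hI0 : 0 ≤ I := integral_nonneg (fun x => le_max_right _ _)
  have hp : 0.398 ≤ (Real.sqrt (2 * Real.pi))⁻¹ := by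
    rw [le_inv_comm₀ (by norm_num) (by positivity), Real.sqrt_le_left (by norm_num)]
    have := Real.pi_lt_d4
    norm_num
    linarith
  have hmul : (T⁻¹ * I) * (Z⁻¹ * (T * K)) = (Real.sqrt (2 * Real.pi))⁻¹ := by
    rw [e1]; field_simp
  rw [div_le_iff₀ hN0]
  calc (0.398:ℝ) ≤ (T⁻¹ * I) * (Z⁻¹ * (T * K)) := by rw [hmul]; exact hp
    _ ≤ (T⁻¹ * I) * Real.sqrt N := mul_le_mul_of_nonneg_left hn (by positivity)

section Outreach

variable {N : ℕ}

lemma outreach_bdd {B : Set (Euc N)} (hB : IsCompact B) (u : Euc N) :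
    BddAbove ((fun b => ⟪b, u⟫) '' B) :=
  (hB.image (by fun_prop : Continuous fun b : Euc N => ⟪b, u⟫)).bddAbove

lemma le_outreach {B : Set (Euc N)} (hB : IsCompact B) (u : Euc N) {b : Euc N} (hb : b ∈ B) :
    ⟪b, u⟫ ≤ outreach B u :=
  le_csSup (outreach_bdd hB u) (mem_image_of_mem _ hb)

lemma outreach_le {B : Set (Euc N)} (hB : B.Nonempty) (u : Euc N) {c : ℝ}
    (h : ∀ b ∈ B, ⟪b, u⟫ ≤ c) : outreach B u ≤ c := by
  apply csSup_le (hB.image _)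
  rintro _ ⟨b, hb, rfl⟩
  exact h b hb

lemma outreach_sub_le {B : Set (Euc N)} (hB : IsCompact B) (hne : B.Nonempty) {R : ℝ}
    (hR : ∀ b ∈ B, ‖b‖ ≤ R) (u v : Euc N) :
    outreach B u ≤ outreach B v + R * ‖u - v‖ := by
  apply outreach_le hne
  intro b hb
  have h1 : ⟪b, u⟫ = ⟪b, v⟫ + ⟪b, u - v⟫ := by rw [inner_sub_right]; ring
  have h2 := real_inner_le_norm b (u - v)
  have h3 := mul_le_mul_of_nonneg_right (hR b hb) (norm_nonneg (u - v))
  have h4 := le_outreach hB v hb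
  linarith

lemma outreach_lip {B : Set (Euc N)} (hB : IsCompact B) (hne : B.Nonempty) {R : ℝ≥0}
    (hR : ∀ b ∈ B, ‖b‖ ≤ R) : LipschitzWith R (outreach B) := by
  apply LipschitzWith.of_le_add_mul
  intro u v
  rw [dist_eq_norm]
  exact outreach_sub_le hB hne hR u v

lemma outreach_abs {B : Set (Euc N)} (hB : IsCompact B) (hne : B.Nonempty) {R : ℝ}
    (hR : ∀ b ∈ B, ‖b‖ ≤ R) (u : Euc N) (hu : ‖u‖ = 1) : |outreach B u| ≤ R := by
  rw [abs_le]
  constructor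
  · obtain ⟨b, hb⟩ := hne
    have h1 := abs_le.1 (abs_real_inner_le_norm b u)
    rw [hu, mul_one] at h1
    linarith [le_outreach hB u hb, hR b hb]
  · apply outreach_le hne
    intro b hb
    have h1 := real_inner_le_norm b u
    rw [hu, mul_one] at h1
    linarith [hR b hb]

lemma outreach_ball {M : ℝ} (hM : 0 ≤ M) (u : Euc N) (hu : ‖u‖ = 1) :
    outreach (closedBall (0 : Euc N) M) u = M := by
  apply le_antisymm
  · exact (abs_le.1 (outreach_abs (isCompact_closedBall _ _) ⟨0, by simpa using hM⟩
      (fun b hb => by simpa using hb) u hu)).2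
  · have h := le_outreach (isCompact_closedBall (0 : Euc N) M) u (b := M • u)
      (by simp [norm_smul, hu, abs_of_nonneg hM])
    rw [real_inner_smul_left, real_inner_self_eq_norm_sq, hu] at h
    linarith

open Pointwise in
lemma outreach_add_ball {B : Set (Euc N)} (hB : IsCompact B) (hne : B.Nonempty) {M : ℝ}
    (hM : 0 ≤ M) (u : Euc N) (hu : ‖u‖ = 1) :
    outreach (B + closedBall (0 : Euc N) M) u = outreach B u + M := by
  have hbc := isCompact_closedBall (0 : Euc N) M
  have hbn : (closedBall (0 : Euc N) M).Nonempty := ⟨0, by simpa using hM⟩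
  apply le_antisymm
  · apply outreach_le (hne.add hbn)
    rintro _ ⟨b, hb, c, hc, rfl⟩
    have h1 := le_outreach hB u hb
    have h2 := le_outreach hbc u hc
    rw [outreach_ball hM u hu] at h2
    change ⟪b + c, u⟫ ≤ _
    rw [inner_add_left]
    linarith
  · rw [← le_sub_iff_add_le]
    apply outreach_le hne
    intro b hb
    have h := le_outreach (hB.add hbc) u (b := b + M • u)
      (Set.add_mem_add hb (by simp [norm_smul, hu, abs_of_nonneg hM]))
    rw [inner_add_left, real_inner_smul_left, real_inner_self_eq_norm_sq, hu] at h
    linarith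

lemma sphere_norm (x : sphere (0 : Euc N) 1) : ‖(x : Euc N)‖ = 1 := by
  simp

lemma supNorm_le (hN : 2 ≤ N) (f : Euc N → ℝ) {c : ℝ} (h : ∀ u : Euc N, ‖u‖ = 1 → |f u| ≤ c) :
    supNormSphere f ≤ c := by
  have : Nonempty (Fin N) := ⟨⟨0, by omega⟩⟩
  have : Nontrivial (Euc N) := inferInstance
  have : Nonempty (sphere (0 : Euc N) 1) :=
    (NormedSpace.sphere_nonempty (x := (0 : Euc N)) (r := 1)).2 zero_le_one |>.to_subtype
  exact ciSup_le fun x => h x (sphere_norm x)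

lemma le_supNorm {f : Euc N → ℝ} (hf : ContinuousOn f (sphere (0 : Euc N) 1)) (u : Euc N)
    (hu : ‖u‖ = 1) : |f u| ≤ supNormSphere f := by
  have hc : IsCompact (range fun x : sphere (0 : Euc N) 1 => |f x|) := by
    apply isCompact_range
    exact (continuousOn_iff_continuous_domRestrict.1 hf).abs
  exact le_ciSup hc.bddAbove (⟨u, by simpa using hu⟩ : sphere (0 : Euc N) 1)

lemma sphere_integrable (hN : 2 ≤ N) {f : Euc N → ℝ} (hf : Continuous f) :
    Integrable (fun x : sphere (0 : Euc N) 1 => f x) (sphereMeasure N) := by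
  have := sphere_prob hN
  exact (by fun_prop : Continuous fun x : sphere (0 : Euc N) 1 => f x).integrable_of_hasCompactSupport
    (HasCompactSupport.of_compactSpace _)

lemma exists_radius {B : Set (Euc N)} (hB : IsCompact B) (hne : B.Nonempty) :
    ∃ b ∈ B, ∀ c ∈ B, ‖c‖ ≤ ‖b‖ :=
  hB.exists_isMaxOn hne continuous_norm.continuousOn

/-- pointwise lower bound -/
lemma outreach_lower {B : Set (Euc N)} (hB : IsCompact B) {M : ℝ} (hM : 0 ≤ M) {b : Euc N}
    (hb : b ∈ B) (u : Euc N) (h : -M ≤ outreach B u) :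
    max ⟪b, u⟫ 0 - M ≤ outreach B u := by
  have h1 := le_outreach hB u hb
  rcases max_cases ⟪b, u⟫ 0 with ⟨h2, _⟩ | ⟨h2, _⟩ <;> rw [h2] <;> linarith

lemma disp_le {m : ℕ} (hm : 0 < m) (u : Fin m → Euc N) (hu : ∀ i, ‖u i‖ = 1)
    (v : Euc N) (hv : ‖v‖ = 1) :
    ∃ i, ‖v - u i‖ ≤ dispersion (Set.range u) := by
  have hne : Nonempty (range u) := ⟨⟨u ⟨0, hm⟩, mem_range_self _⟩⟩
  have hbelow : ∀ x : Euc N, BddBelow (range fun y : range u => ‖x - (y : Euc N)‖) := fun x =>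
    ⟨0, by rintro _ ⟨y, rfl⟩; exact norm_nonneg _⟩
  have hle : ⨅ y : range u, ‖v - (y : Euc N)‖ ≤ dispersion (Set.range u) := by
    apply le_ciSup (f := fun x : sphere (0 : Euc N) 1 => ⨅ y : range u, ‖(x : Euc N) - (y : Euc N)‖)
      _ (⟨v, by simpa using hv⟩ : sphere (0 : Euc N) 1)
    refine ⟨2, ?_⟩
    rintro _ ⟨x, rfl⟩
    refine (ciInf_le (hbelow x) (⟨u ⟨0, hm⟩, mem_range_self _⟩ : range u)).trans ?_
    refine (norm_sub_le _ _).trans ?_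
    rw [sphere_norm x]
    change 1 + ‖u ⟨0, hm⟩‖ ≤ 2
    rw [hu]
    norm_num
  obtain ⟨y, hy⟩ := exists_eq_ciInf_of_finite (f := fun y : range u => ‖v - (y : Euc N)‖)
  obtain ⟨_, i, rfl⟩ := y
  exact ⟨i, by rw [← hy] at hle; exact hle⟩

end Outreach
open scoped Pointwise
/-- under the standing assumptions on the quadrature,
`𝒞^0 ⊆ 𝒟^γ` for `γ = 16√N‖C‖_∞(2ε + δ) + L_C δ`. -/
theorem COpt_subset_DGamma {N m : ℕ} (hN : 2 ≤ N)
    (u : Fin m → Euc N) (w : Fin m → ℝ) (ε : ℝ)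
    (hq : IsAccurateQuadrature u w ε)
    (δ : ℝ) (hδ : δ = dispersion (Set.range u))
    (hε : ε ≤ 1 / (10 * Real.sqrt N)) (hδ' : δ ≤ 1 / (10 * Real.sqrt N))
    (C : Euc N → ℝ) (LC : ℝ≥0) (hC : LipschitzOnWith LC C (Metric.sphere (0 : Euc N) 1))
    (γ : ℝ) (hγ : γ = 16 * Real.sqrt N * supNormSphere C * (2 * ε + δ) + (LC : ℝ) * δ) :
    CGamma C 0 ⊆ DGamma u w C γ := by
  obtain ⟨hu, hw, hqf⟩ := hq
  have hu1 : ∀ i, ‖u i‖ = 1 := fun i => by simpa using hu i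
  have hprob := sphere_prob hN
  have hs2 : (1.414 : ℝ) ≤ Real.sqrt N := by
    apply Real.le_sqrt_of_sq_le
    have : (2:ℝ) ≤ N := by exact_mod_cast hN
    norm_num
    linarith
  set s := Real.sqrt N with hs
  have hs0 : 0 < s := by linarith
  have hεs : ε * s ≤ 0.1 := by
    rw [le_div_iff₀ (by positivity)] at hε
    linarith
  -- total weight
  have hW : |1 - ∑ i, w i| ≤ ε := by
    have h := hqf 0 (fun _ => 1) (LipschitzWith.const _).lipschitzOnWith
    have h1 : supNormSphere (fun _ : Euc N => (1:ℝ)) ≤ 1 := supNorm_le hN _ (by simp)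
    have h2 := le_supNorm (f := fun _ : Euc N => (1:ℝ)) continuousOn_const
    have h3 : supNormSphere (fun _ : Euc N => (1:ℝ)) = 1 := by
      have : Nonempty (Fin N) := ⟨⟨0, by omega⟩⟩
      have : Nontrivial (Euc N) := inferInstance
      obtain ⟨v, hv⟩ := exists_norm_eq (Euc N) zero_le_one
      have := h2 v hv
      simp at this
      linarith
    rw [h3] at h
    simpa using h
  have hε0 : 0 ≤ ε := (abs_nonneg _).trans hW
  have hW' := abs_le.1 hW
  have hεn : ε ≤ 0.0708 := by nlinarith
  have hm : 0 < m := by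
    rcases Nat.eq_zero_or_pos m with rfl | h
    · simp at hW'
      linarith
    · exact h
  have hdisp : ∀ v : Euc N, ‖v‖ = 1 → ∃ i, ‖v - u i‖ ≤ δ := fun v hv => by
    rw [hδ]; exact disp_le hm u hu1 v hv
  have hδ0 : 0 ≤ δ := by
    obtain ⟨i, hi⟩ := hdisp (u ⟨0, hm⟩) (hu1 _)
    exact (norm_nonneg _).trans hi
  set M := supNormSphere C with hMdef
  have hCM : ∀ v : Euc N, ‖v‖ = 1 → |C v| ≤ M := le_supNorm hC.continuousOn
  have hM0 : 0 ≤ M := (abs_nonneg _).trans (hCM (u ⟨0, hm⟩) (hu1 _))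
  -- the ball
  have hbne : (closedBall (0 : Euc N) M).Nonempty := ⟨0, by simpa using hM0⟩
  have hballC : closedBall (0 : Euc N) M ∈ CInf C := by
    refine ⟨hbne, convex_closedBall _ _, isCompact_closedBall _ _, fun v hv => ?_⟩
    have hv1 : ‖v‖ = 1 := by simpa using hv
    rw [outreach_ball hM0 v hv1]
    exact (abs_le.1 (hCM v hv1)).2
  have hCD : CInf C ⊆ DInf C (range u) := by
    rintro B ⟨h1, h2, h3, h4⟩
    refine ⟨h1, h2, h3, ?_⟩
    rintro _ ⟨i, rfl⟩
    exact h4 _ (hu i)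
  have hmb : meanHalfWidth (closedBall (0 : Euc N) M) = M := by
    unfold meanHalfWidth
    simp_rw [outreach_ball hM0 _ (sphere_norm _)]
    simp
  have hqb : quadSum u w (closedBall (0 : Euc N) M) = M * ∑ i, w i := by
    unfold quadSum
    simp_rw [outreach_ball hM0 _ (hu1 _)]
    rw [← Finset.sum_mul, mul_comm]
  -- integrability
  have hInt : ∀ B : Set (Euc N), B.Nonempty → IsCompact B →
      Integrable (fun x : sphere (0 : Euc N) 1 => outreach B x) (sphereMeasure N) := by
    intro B hne hB
    obtain ⟨b, hb, hbR⟩ := exists_radius hB hne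
    exact sphere_integrable hN
      (outreach_lip hB hne (R := ‖b‖₊) (by simpa using hbR)).continuous
  -- lower bound on continuous objective
  have hlow : ∀ B ∈ CInf C, ∀ b ∈ B, 0.398 / s * ‖b‖ - M ≤ meanHalfWidth B := by
    rintro B ⟨hne, hcv, hB, hf⟩ b hb
    have h1 := sphere_pos_part hN b
    have hi : Integrable (fun x : sphere (0 : Euc N) 1 => max ⟪b, (x : Euc N)⟫ 0)
        (sphereMeasure N) :=
      sphere_integrable hN (f := fun x => max ⟪b, x⟫ 0) (by fun_prop)
    have h2 : ∫ x : sphere (0 : Euc N) 1, (max ⟪b, (x : Euc N)⟫ 0 - M) ∂(sphereMeasure N) ≤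
        meanHalfWidth B := by
      apply integral_mono (hi.sub (integrable_const _)) (hInt B hne hB)
      intro x
      apply outreach_lower hB hM0 hb
      have := (abs_le.1 (hCM x (sphere_norm x))).1
      exact this.trans (hf x x.2)
    rw [integral_sub hi (integrable_const _)] at h2
    simp at h2
    linarith
  have hbdd : BddBelow (meanHalfWidth '' CInf C) := by
    refine ⟨-M, ?_⟩
    rintro _ ⟨B, hB, rfl⟩
    obtain ⟨b, hb⟩ := hB.1
    have h1 := hlow B hB b hb
    have : 0 ≤ 0.398 / s * ‖b‖ := by positivity
    linarith
  have hVle : ∀ B ∈ CInf C, VCP C ≤ meanHalfWidth B := fun B hB =>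
    csInf_le hbdd (mem_image_of_mem _ hB)
  -- quadrature error
  have hquad : ∀ B : Set (Euc N), B.Nonempty → IsCompact B → ∀ R : ℝ, 0 ≤ R →
      (∀ b ∈ B, ‖b‖ ≤ R) → |meanHalfWidth B - quadSum u w B| ≤ 2 * ε * R := by
    intro B hne hB R hR0 hR
    have h := hqf ⟨R, hR0⟩ (outreach B) (outreach_lip hB hne (R := ⟨R, hR0⟩) hR).lipschitzOnWith
    have h1 : supNormSphere (outreach B) ≤ R := supNorm_le hN _ (outreach_abs hB hne hR)
    refine h.trans ?_
    have h2 : ε * (R + supNormSphere (outreach B)) ≤ ε * (R + R) := by gcongr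
    change ε * (R + supNormSphere (outreach B)) ≤ _
    linarith
  rintro B ⟨hBC, hBopt⟩
  refine ⟨hCD hBC, ?_⟩
  obtain ⟨b, hb, hbR⟩ := exists_radius hBC.2.2.1 hBC.1
  have hRB : ‖b‖ ≤ 5.026 * s * M := by
    have h1 := hlow B hBC b hb
    have h2 := hVle _ hballC
    rw [hmb] at h2
    have h3 : 0.398 / s * ‖b‖ ≤ 2 * M := by linarith
    rw [div_mul_eq_mul_div, div_le_iff₀ hs0] at h3
    nlinarith [mul_nonneg hs0.le hM0]
  have hqB := (abs_le.1 (hquad B hBC.1 hBC.2.2.1 ‖b‖ (norm_nonneg _) hbR)).1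
  have main : ∀ D ∈ DInf C (range u), quadSum u w D ≤ quadSum u w (closedBall (0 : Euc N) M) →
      quadSum u w B ≤ quadSum u w D + γ := by
    rintro D ⟨hDne, hDcv, hD, hDf⟩ hDq
    obtain ⟨d, hd, hdR⟩ := exists_radius hD hDne
    have hRD : ‖d‖ ≤ 10.9 * s * M := by
      have h1 := sphere_pos_part hN d
      have h2 := hqf ‖d‖₊ (fun x => max ⟪d, x⟫ 0) (by
        apply LipschitzWith.lipschitzOnWith
        have hl : LipschitzWith ‖d‖₊ (fun x : Euc N => ⟪d, x⟫) := by
          apply LipschitzWith.of_le_add_mul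
          intro x y
          have e : ⟪d, x⟫ = ⟪d, y⟫ + ⟪d, x - y⟫ := by rw [inner_sub_right]; ring
          rw [e, dist_eq_norm]
          have := real_inner_le_norm d (x - y)
          simpa using this
        exact hl.max_const 0)
      have h3 : supNormSphere (fun x : Euc N => max ⟪d, x⟫ 0) ≤ ‖d‖ := by
        apply supNorm_le hN
        intro x hx
        rw [abs_of_nonneg (le_max_right _ _)]
        apply max_le _ (norm_nonneg _)
        have := real_inner_le_norm d x
        rwa [hx, mul_one] at this
      have h4 : ε * (((‖d‖₊ : ℝ≥0) : ℝ) + supNormSphere (fun x : Euc N => max ⟪d, x⟫ 0)) ≤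
          ε * (‖d‖ + ‖d‖) := by
        rw [coe_nnnorm]
        gcongr
      have h5 := (abs_le.1 (h2.trans h4)).2
      have h6 : ∑ i, w i * max ⟪d, u i⟫ 0 - M * ∑ i, w i ≤ quadSum u w D := by
        unfold quadSum
        rw [Finset.mul_sum, ← Finset.sum_sub_distrib]
        apply Finset.sum_le_sum
        intro i _
        have h7 : max ⟪d, u i⟫ 0 - M ≤ outreach D (u i) := by
          apply outreach_lower hD hM0 hd
          exact (abs_le.1 (hCM _ (hu1 i))).1.trans (hDf _ (mem_range_self i))
        have := mul_le_mul_of_nonneg_left h7 (hw i)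
        linarith
      rw [hqb] at hDq
      have h8 : M * ∑ i, w i ≤ M * 1.0708 := mul_le_mul_of_nonneg_left (by linarith) hM0
      have h9 : 0.398 / s * ‖d‖ ≤ 2 * ε * ‖d‖ + 2 * (M * 1.0708) := by
        linarith
      have h10 : 0.398 * ‖d‖ ≤ (2 * ε * ‖d‖ + 2 * (M * 1.0708)) * s := by
        rw [div_mul_eq_mul_div, div_le_iff₀ hs0] at h9
        exact h9
      have h11 : ε * s * ‖d‖ ≤ 0.1 * ‖d‖ := mul_le_mul_of_nonneg_right hεs (norm_nonneg _)
      nlinarith [mul_nonneg hs0.le hM0]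
    have hqD := (abs_le.1 (hquad D hDne hD ‖d‖ (norm_nonneg _) hdR)).2
    set t : ℝ := (‖d‖ + LC) * δ with ht
    have ht0 : 0 ≤ t := by positivity
    have hD' : D + closedBall (0 : Euc N) t ∈ CInf C := by
      refine ⟨hDne.add ⟨0, by simpa using ht0⟩, hDcv.add (convex_closedBall _ _),
        hD.add (isCompact_closedBall _ _), fun v hv => ?_⟩
      have hv1 : ‖v‖ = 1 := by simpa using hv
      rw [outreach_add_ball hD hDne ht0 v hv1]
      obtain ⟨i, hi⟩ := hdisp v hv1
      have h1 := hC.dist_le_mul v hv (u i) (hu i)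
      rw [Real.dist_eq, dist_eq_norm] at h1
      have h2 := (abs_le.1 h1).2
      have h3 := hDf _ (mem_range_self i)
      have h4 := outreach_sub_le hD hDne hdR (u i) v
      rw [norm_sub_rev] at h4
      have h5 : (‖d‖ + LC) * ‖v - u i‖ ≤ t := mul_le_mul_of_nonneg_left hi (by positivity)
      linarith
    have hmD' : meanHalfWidth (D + closedBall (0 : Euc N) t) = meanHalfWidth D + t := by
      unfold meanHalfWidth
      simp_rw [outreach_add_ball hD hDne ht0 _ (sphere_norm _)]
      rw [integral_add (hInt D hDne hD) (integrable_const _)]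
      simp
    have hV := hVle _ hD'
    rw [hmD'] at hV
    have h1 : quadSum u w B ≤ quadSum u w D + 2 * ε * (‖b‖ + ‖d‖) + t := by linarith
    have h2 : 2 * ε * (‖b‖ + ‖d‖) ≤ 2 * ε * (16 * s * M) := by
      apply mul_le_mul_of_nonneg_left _ (by positivity)
      nlinarith [mul_nonneg hs0.le hM0]
    have h3 : ‖d‖ * δ ≤ 16 * s * M * δ := by
      apply mul_le_mul_of_nonneg_right _ hδ0
      nlinarith [mul_nonneg hs0.le hM0]
    rw [hγ]
    linarith
  have hfin : quadSum u w B - γ ≤ VDP u w C := by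
    apply le_csInf ⟨_, mem_image_of_mem _ (hCD hBC)⟩
    rintro _ ⟨D, hD, rfl⟩
    by_cases h : quadSum u w D ≤ quadSum u w (closedBall (0 : Euc N) M)
    · linarith [main D hD h]
    · linarith [main _ (hCD hballC) le_rfl]
  linarith
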